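/- The λ-open topology τ_λ makes C(X,ℝ^ι) a locally convex topological vector space over ℝ (a topological vector space having a neighborhood base at 0 consisting of convex sets) if and only if every member of λ is C_ι-compact in X and λ = λ(C_ι). -/

import Mathlib

open Topology Set

/-- The λ-open (set-open) topology on `C(X, ι → ℝ)` generated by the subbasis
`[A, U] = {f | f(A) ⊆ U}` for `A ∈ Λ` and `U` open in `ι → ℝ`. -/
def setOpenTopology {X : Type*} [TopologicalSpace X] (ι : Type*) (Λ : Set (Set X)) :
    TopologicalSpace C(X, ι → ℝ) :=
  TopologicalSpace.generateFrom
    {S | ∃ A ∈ Λ, ∃ U : Set (ι → ℝ), IsOpen U ∧ S = {f : C(X, ι → ℝ) | Set.MapsTo f A U}}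

/-- A subset `B ⊆ X` is `C_ι`-compact in `X` if `f(B)` is compact in `ℝ^ι`
for every continuous `f : X → ℝ^ι`. -/
def CCompactIn {X : Type*} [TopologicalSpace X] (ι : Type*) (B : Set X) : Prop :=
  ∀ f : C(X, ι → ℝ), IsCompact (⇑f '' B)

/-- The family `λ(C_ι)`. -/
def lambdaC {X : Type*} [TopologicalSpace X] (ι : Type*) (Λ : Set (Set X)) : Set (Set X) :=
  {A | A ∈ Λ ∧ ∀ B ⊆ A, CCompactIn ι B → ∀ U : Set (ι → ℝ), IsOpen U →
    IsOpen[setOpenTopology ι Λ] {f : C(X, ι → ℝ) | Set.MapsTo f B U}}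

theorem WithSeminorms.continuous_add_smul_and_exists_convex {E J : Type*} [AddCommGroup E]
    [Module ℝ E] {t : TopologicalSpace E} {p : SeminormFamily ℝ E J} (hp : WithSeminorms p) :
    Continuous (fun q : E × E => q.1 + q.2) ∧ Continuous (fun q : ℝ × E => q.1 • q.2) ∧
      ∀ S ∈ 𝓝 (0 : E), ∃ T ∈ 𝓝 (0 : E), Convex ℝ T ∧ T ⊆ S := by
  have := hp.topologicalAddGroup
  have := hp.continuousSMul
  refine ⟨continuous_add, continuous_smul, fun S hS => ?_⟩
  obtain ⟨s, r, hr, h⟩ := (hp.mem_nhds_iff 0 S).1 hS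
  exact ⟨_, (hp.mem_nhds_iff 0 _).2 ⟨s, r, hr, subset_rfl⟩, Seminorm.convex_ball _ _ _, h⟩

theorem WithSeminorms.le_topology_of_forall_mem_nhds {E J : Type*} [AddCommGroup E] [Module ℝ E]
    {t u : TopologicalSpace E} {p : SeminormFamily ℝ E J} (hp : WithSeminorms (topology := u) p)
    (h : ∀ f j ε, 0 < ε → {g | p j (g - f) < ε} ∈ @nhds _ t f) : t ≤ u :=
  le_of_nhds_le_nhds fun f => (@WithSeminorms.tendsto_nhds _ _ _ _ _ _ _ u p hp id _ f).2 (h f)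

theorem isCompact_image_of_isClosed_of_bounded {X ι : Type*} {A : Set X} {f : X → ι → ℝ}
    (hcl : IsClosed (f '' A))
    (hb : ∀ i, ∃ M, ∀ a ∈ A, |f a i| ≤ M) : IsCompact (f '' A) := by
  choose M hM using hb
  refine (isCompact_univ_pi fun i => isCompact_Icc (a := -M i) (b := M i)).of_isClosed_subset hcl ?_
  rintro _ ⟨a, ha, rfl⟩ i -
  exact abs_le.1 (hM i a ha)

section SetOpenTopology

variable {X : Type*} [TopologicalSpace X] {ι : Type*} {Λ : Set (Set X)} {A B : Set X}

theorem isOpen_setOpenTopology_mapsTo (hA : A ∈ Λ) {U : Set (ι → ℝ)} (hU : IsOpen U) :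
    IsOpen[setOpenTopology ι Λ] {f : C(X, ι → ℝ) | MapsTo f A U} :=
  TopologicalSpace.isOpen_generateFrom_of_mem ⟨A, hA, U, hU, rfl⟩

theorem continuous_const_setOpenTopology (hΛ : ∀ A ∈ Λ, A.Nonempty) :
    Continuous[inferInstance, setOpenTopology ι Λ]
      (fun v : ι → ℝ => ContinuousMap.const X v) := by
  refine continuous_generateFrom_iff.2 ?_
  rintro _ ⟨A, hA, U, hU, rfl⟩
  obtain ⟨a, ha⟩ := hΛ A hA
  convert hU using 1
  ext v
  exact ⟨fun h => h ha, fun h _ _ => h⟩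

theorem cCompactIn_of_continuous_add_smul (hΛ : ∀ A ∈ Λ, A.Nonempty)
    (hadd : Continuous[@instTopologicalSpaceProd _ _ (setOpenTopology ι Λ) (setOpenTopology ι Λ),
        setOpenTopology ι Λ] (fun p : C(X, ι → ℝ) × C(X, ι → ℝ) => p.1 + p.2))
    (hsmul : Continuous[@instTopologicalSpaceProd _ _ inferInstance (setOpenTopology ι Λ),
        setOpenTopology ι Λ] (fun p : ℝ × C(X, ι → ℝ) => p.1 • p.2))
    (hA : A ∈ Λ) : CCompactIn ι A := by
  let := setOpenTopology (X := X) ι Λ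
  have : ContinuousAdd C(X, ι → ℝ) := ⟨hadd⟩
  have : ContinuousSMul ℝ C(X, ι → ℝ) := ⟨hsmul⟩
  intro f
  refine isCompact_image_of_isClosed_of_bounded (isClosed_of_closure_subset fun p hp => ?_)
    fun i => ?_
  · by_contra hpA
    have hcont : Continuous fun v : ι → ℝ => f + ContinuousMap.const X (-v) :=
      continuous_const.add ((continuous_const_setOpenTopology hΛ).comp continuous_neg)
    have hopen := (isOpen_setOpenTopology_mapsTo hA
      (isOpen_compl_singleton (x := (0 : ι → ℝ)))).preimage hcont
    obtain ⟨_, hv, a, ha, rfl⟩ := mem_closure_iff.1 hp _ hopen (by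
      intro a ha h
      exact hpA ⟨a, ha, by simpa [add_neg_eq_zero] using h⟩)
    exact hv ha (by simp)
  · have hcont : Continuous fun t : ℝ => t • f := continuous_id.smul continuous_const
    have hU : IsOpen {x : ι → ℝ | |x i| < 1} :=
      isOpen_lt (by fun_prop) continuous_const
    have hmem := ((isOpen_setOpenTopology_mapsTo hA hU).preimage hcont).mem_nhds
      (x := 0) (by intro a _; simp)
    obtain ⟨ε, hε, hball⟩ := Metric.mem_nhds_iff.1 hmem
    have hhalf : ε / 2 ∈ Metric.ball (0 : ℝ) ε := by
      rw [Metric.mem_ball, Real.dist_eq, sub_zero, abs_of_pos (half_pos hε)]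
      exact half_lt_self hε
    refine ⟨(ε / 2)⁻¹, fun a ha => ?_⟩
    have h : |ε / 2 * f a i| < 1 := hball hhalf ha
    rw [abs_mul, abs_of_pos (half_pos hε)] at h
    rw [← one_div, le_div_iff₀' (half_pos hε)]
    exact h.le

theorem isOpen_setOpenTopology_mapsTo_of_subset
    (hadd : Continuous[@instTopologicalSpaceProd _ _ (setOpenTopology ι Λ) (setOpenTopology ι Λ),
        setOpenTopology ι Λ] (fun p : C(X, ι → ℝ) × C(X, ι → ℝ) => p.1 + p.2))
    (hA : A ∈ Λ) (hBA : B ⊆ A) (hB : CCompactIn ι B) {U : Set (ι → ℝ)} (hU : IsOpen U) :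
    IsOpen[setOpenTopology ι Λ] {f : C(X, ι → ℝ) | MapsTo f B U} := by
  let := setOpenTopology (X := X) ι Λ
  have : ContinuousAdd C(X, ι → ℝ) := ⟨hadd⟩
  refine isOpen_iff_mem_nhds.2 fun f hf => ?_
  obtain ⟨V, hV, hVU⟩ := compact_open_separated_add_right (hB f) hU (image_subset_iff.2 hf)
  obtain ⟨W, hWV, hW, h0⟩ := mem_nhds_iff.1 hV
  have hcont : Continuous fun g : C(X, ι → ℝ) => g + -f := continuous_id.add continuous_const
  have hmem := ((isOpen_setOpenTopology_mapsTo hA hW).preimage hcont).mem_nhds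
    (x := f) (by intro a _; simpa using h0)
  filter_upwards [hmem] with g hg b hb
  exact hVU ⟨f b, mem_image_of_mem _ hb, _, hWV (hg (hBA hb)), by simp⟩

theorem CCompactIn.isCompact_image_real [Nonempty ι] (hA : CCompactIn ι A) {φ : X → ℝ}
    (hφ : Continuous φ) : IsCompact (φ '' A) := by
  obtain ⟨i⟩ := ‹Nonempty ι›
  have h := (hA ⟨fun x _ => φ x, by fun_prop⟩).image (continuous_apply i)
  rwa [image_image] at h

theorem CCompactIn.exists_abs_le (hA : CCompactIn ι A) (f : C(X, ι → ℝ)) (i : ι) :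
    ∃ M, ∀ a ∈ A, |f a i| ≤ M := by
  obtain ⟨M, hM⟩ := ((hA f).image (f := fun x : ι → ℝ => |x i|) (by fun_prop)).bddAbove
  exact ⟨M, fun a ha => hM ⟨f a, mem_image_of_mem _ ha, rfl⟩⟩

/-- The part of a `C_ι`-compact set on which a continuous real function is nonpositive
is `C_ι`-compact. -/
theorem CCompactIn.inter_nonpos [Nonempty ι] (hA : CCompactIn ι A) {φ : X → ℝ}
    (hφ : Continuous φ) : CCompactIn ι (A ∩ {x | φ x ≤ 0}) := by
  intro g
  rcases finite_or_infinite ι with hι | hι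
  · have := Fintype.ofFinite ι
    refine isCompact_image_of_isClosed_of_bounded (isClosed_of_closure_subset fun p hp => ?_)
      fun i => (hA.exists_abs_le g i).imp fun M hM a ha => hM a ha.1
    have hψ : Continuous fun x => max (φ x) (dist (g x) p) := by fun_prop
    have h0 : (0 : ℝ) ∈ closure ((fun x => max (φ x) (dist (g x) p)) '' A) := by
      refine Metric.mem_closure_iff.2 fun ε hε => ?_
      obtain ⟨_, ⟨a, ha, rfl⟩, hd⟩ := Metric.mem_closure_iff.1 hp ε hε
      refine ⟨_, ⟨a, ha.1, rfl⟩, ?_⟩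
      have : max (φ a) (dist (g a) p) = dist (g a) p := max_eq_right (ha.2.trans dist_nonneg)
      change dist 0 (max (φ a) (dist (g a) p)) < ε
      rwa [this, Real.dist_eq, zero_sub, abs_neg, abs_of_nonneg dist_nonneg, dist_comm]
    obtain ⟨a, ha, h⟩ := (hA.isCompact_image_real hψ).isClosed.closure_subset h0
    have h := max_le_iff.1 h.le
    exact ⟨a, ⟨ha, h.1⟩, dist_le_zero.1 h.2⟩
  · obtain ⟨e⟩ := Cardinal.eq.1 ((Cardinal.mk_option (α := ι)).trans Cardinal.mk_add_one_eq)
    let F : C(X, ι → ℝ) :=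
      ⟨fun x j => (e.symm j).elim (φ x) (g x), by
        refine continuous_pi fun j => ?_
        cases e.symm j with
        | none => exact hφ
        | some i => exact (continuous_apply i).comp g.continuous⟩
    have hF : IsCompact (F '' A ∩ {y | y (e none) ≤ 0}) :=
      (hA F).inter_right (isClosed_le (by fun_prop) continuous_const)
    convert hF.image (f := fun y i => y (e (some i))) (by fun_prop) using 1
    ext y
    constructor
    · rintro ⟨a, ⟨ha, h⟩, rfl⟩
      exact ⟨F a, ⟨mem_image_of_mem _ ha, by simpa [F] using h⟩, by simp [F]⟩
    · rintro ⟨_, ⟨⟨a, ha, rfl⟩, h⟩, rfl⟩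
      exact ⟨a, ⟨ha, by simpa [F] using h⟩, by simp [F]⟩

/-- The seminorm `f ↦ sup_{x ∈ A} |f x i|` on `C(X, ι → ℝ)` for a `C_ι`-compact set `A`. -/
noncomputable def CCompactIn.supSeminorm (hA : CCompactIn ι A) (i : ι) :
    Seminorm ℝ C(X, ι → ℝ) :=
  have hbdd (f : C(X, ι → ℝ)) : BddAbove (range fun x : A => |f x i|) := by
    obtain ⟨M, hM⟩ := hA.exists_abs_le f i
    exact ⟨M, by rintro _ ⟨x, rfl⟩; exact hM x x.2⟩
  Seminorm.of (fun f => ⨆ x : A, |f x i|)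
    (fun f g => Real.iSup_le
      (fun x => (abs_add_le _ _).trans (add_le_add (le_ciSup (hbdd f) x) (le_ciSup (hbdd g) x)))
      (add_nonneg (Real.iSup_nonneg fun _ => abs_nonneg _)
        (Real.iSup_nonneg fun _ => abs_nonneg _)))
    (fun c f => by simp [abs_mul, Real.mul_iSup_of_nonneg])

theorem CCompactIn.supSeminorm_apply (hA : CCompactIn ι A) (i : ι) (f : C(X, ι → ℝ)) :
    hA.supSeminorm i f = ⨆ x : A, |f x i| :=
  rfl

theorem CCompactIn.abs_le_supSeminorm (hA : CCompactIn ι A) (i : ι) (f : C(X, ι → ℝ))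
    {a : X} (ha : a ∈ A) : |f a i| ≤ hA.supSeminorm i f := by
  obtain ⟨M, hM⟩ := hA.exists_abs_le f i
  exact le_ciSup (f := fun x : A => |f x i|) ⟨M, by rintro _ ⟨x, rfl⟩; exact hM x x.2⟩ ⟨a, ha⟩

theorem CCompactIn.supSeminorm_le (hA : CCompactIn ι A) (i : ι) (f : C(X, ι → ℝ))
    {r : ℝ} (hr : 0 ≤ r) (h : ∀ a ∈ A, |f a i| ≤ r) : hA.supSeminorm i f ≤ r :=
  Real.iSup_le (fun x => h x x.2) hr

theorem WithSeminorms.setOpenTopology [Nonempty ι] (hΛ : ∀ A ∈ Λ, CCompactIn ι A)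
    (hsub : ∀ A ∈ Λ, ∀ B ⊆ A, CCompactIn ι B → ∀ U : Set (ι → ℝ), IsOpen U →
      IsOpen[setOpenTopology ι Λ] {f : C(X, ι → ℝ) | MapsTo f B U}) :
    WithSeminorms (topology := setOpenTopology ι Λ)
      (fun j : Λ × ι => (hΛ j.1 j.1.2).supSeminorm j.2) := by
  set p : SeminormFamily ℝ C(X, ι → ℝ) (Λ × ι) :=
    fun j => (hΛ j.1 j.1.2).supSeminorm j.2 with hp
  have hw : WithSeminorms (topology := p.moduleFilterBasis.topology) p :=
    @WithSeminorms.mk _ _ _ _ _ _ _ (_) rfl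
  refine @WithSeminorms.mk _ _ _ _ _ _ _ (_) (le_antisymm ?_ ?_)
  · let := _root_.setOpenTopology (X := X) ι Λ
    refine hw.le_topology_of_forall_mem_nhds ?_
    rintro f ⟨⟨A, hA⟩, i⟩ ε hε
    have hfi : Continuous fun x => f x i := by fun_prop
    obtain ⟨t, -, htf, ht⟩ := finite_cover_balls_of_compact
      ((hΛ A hA).isCompact_image_real hfi) (show 0 < ε / 4 by positivity)
    have hmem : ∀ c ∈ t, {g : C(X, ι → ℝ) |
        MapsTo g (A ∩ {x | |f x i - c| - ε / 4 ≤ 0}) {y | |y i - c| < ε / 2}} ∈ 𝓝 f := by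
      intro c _
      refine (hsub A hA _ inter_subset_left ((hΛ A hA).inter_nonpos (by fun_prop)) _
        (isOpen_lt (by fun_prop) continuous_const)).mem_nhds ?_
      rintro x ⟨-, hx⟩
      simp only [mem_ofPred_eq] at hx ⊢
      linarith
    filter_upwards [(Filter.biInter_mem htf).2 hmem] with g hg
    refine ((hΛ A hA).supSeminorm_le i (g - f) (r := 3 * ε / 4) (by positivity) ?_).trans_lt
      (by linarith)
    intro a ha
    obtain ⟨c, hc, hac⟩ := mem_iUnion₂.1 (ht (mem_image_of_mem _ ha))
    rw [Metric.mem_ball, Real.dist_eq] at hac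
    have hga : |g a i - c| < ε / 2 :=
      mem_iInter₂.1 hg c hc ⟨ha, by simp only [mem_ofPred_eq]; linarith⟩
    have : |g a i - f a i| ≤ |g a i - c| + |c - f a i| := abs_sub_le _ _ _
    rw [abs_sub_comm c] at this
    simp only [ContinuousMap.sub_apply, Pi.sub_apply]
    linarith
  · refine le_generateFrom ?_
    rintro _ ⟨A, hA, U, hU, rfl⟩
    let := p.moduleFilterBasis.topology
    refine isOpen_iff_mem_nhds.2 fun f hf => ?_
    obtain ⟨V, hV, hVU⟩ := compact_open_separated_add_right (hΛ A hA f) hU (image_subset_iff.2 hf)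
    rw [nhds_pi, Filter.mem_pi] at hV
    obtain ⟨I, hI, s, hs, hsV⟩ := hV
    have hmem : ∀ i ∈ I, {g : C(X, ι → ℝ) | ∀ a ∈ A, g a i - f a i ∈ s i} ∈ 𝓝 f := by
      intro i _
      obtain ⟨ε, hε, hball⟩ := Metric.mem_nhds_iff.1 (hs i)
      filter_upwards [(hw.tendsto_nhds id f).1 Filter.tendsto_id (⟨A, hA⟩, i) ε hε] with g hg a ha
      refine hball ?_
      rw [Metric.mem_ball, Real.dist_eq]
      simpa using ((hΛ A hA).abs_le_supSeminorm i (g - f) ha).trans_lt hg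
    filter_upwards [(Filter.biInter_mem hI).2 hmem] with g hg a ha
    exact hVU ⟨f a, mem_image_of_mem _ ha, g a - f a,
      hsV fun i hi => mem_iInter₂.1 hg i hi a ha, by simp⟩

end SetOpenTopology

theorem statement_5 {X : Type*} [TopologicalSpace X] [T35Space X]
    (ι : Type*) [Nonempty ι] (Λ : Set (Set X)) (hΛ : ∀ A ∈ Λ, A.Nonempty) :
    (Continuous[@instTopologicalSpaceProd _ _ (setOpenTopology ι Λ) (setOpenTopology ι Λ),
        setOpenTopology ι Λ]
        (fun p : C(X, ι → ℝ) × C(X, ι → ℝ) => p.1 + p.2) ∧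
      Continuous[@instTopologicalSpaceProd _ _ inferInstance (setOpenTopology ι Λ),
        setOpenTopology ι Λ]
        (fun p : ℝ × C(X, ι → ℝ) => p.1 • p.2) ∧
      ∀ S ∈ @nhds _ (setOpenTopology ι Λ) (0 : C(X, ι → ℝ)),
        ∃ T ∈ @nhds _ (setOpenTopology ι Λ) (0 : C(X, ι → ℝ)), Convex ℝ T ∧ T ⊆ S) ↔
    (∀ A ∈ Λ, CCompactIn ι A) ∧ Λ = lambdaC ι Λ := by
  constructor
  · rintro ⟨hadd, hsmul, -⟩
    exact ⟨fun A hA => cCompactIn_of_continuous_add_smul hΛ hadd hsmul hA,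
      Subset.antisymm (fun A hA => ⟨hA, fun B hBA hB U hU =>
        isOpen_setOpenTopology_mapsTo_of_subset hadd hA hBA hB hU⟩) fun A hA => hA.1⟩
  · rintro ⟨hC, heq⟩
    exact (WithSeminorms.setOpenTopology hC
      fun A hA => (heq.subset hA).2).continuous_add_smul_and_exists_convex
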